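/- For every n ≥ 1 there is a constant C, depending only on n, such that the following holds. Let S₁,…,S_N be finitely many pairwise disjoint cubes in ℝⁿ, let α > 0, and let μ₁,…,μ_N ≥ 0 satisfy μ_l ≤ α·|S_l| for each l. Then for every x ∈ ℝⁿ with x ∉ (8√n)·S_l for all l, and every y₁ ∈ ℝⁿ with y₁ ≠ x, ∑_{l=1}^N μ_l · sup_{y₂ ∈ S_l} (|x−y₁|+|x−y₂|)^{−2n} ≤ C·α·|x−y₁|^{−n}. -/

import Mathlib

open MeasureTheory Set

noncomputable section

/-- Euclidean space `ℝⁿ`. -/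
abbrev Rn (n : ℕ) : Type := EuclideanSpace ℝ (Fin n)

/-- The (closed) axis-parallel cube with center `c` and side length `l`. -/
def cube {n : ℕ} (c : Rn n) (l : ℝ) : Set (Rn n) :=
  {x : Rn n | ∀ i, |x i - c i| ≤ l / 2}

theorem isClosed_cube {n : ℕ} (c : Rn n) (l : ℝ) : IsClosed (cube c l) := by
  simp only [cube, ofPred_forall]
  exact isClosed_iInter fun i => isClosed_le (by fun_prop) continuous_const

theorem norm_sub_le_of_mem_cube {n : ℕ} {c y z : Rn n} {l : ℝ} (hl : 0 ≤ l)
    (hy : y ∈ cube c l) (hz : z ∈ cube c l) : ‖y - z‖ ≤ Real.sqrt n * l := by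
  have hi : ∀ i, ‖(y - z) i‖ ^ 2 ≤ l ^ 2 := fun i => by
    have h : |y i - z i| ≤ l := by
      have h1 := abs_le.1 (hy i)
      have h2 := abs_le.1 (hz i)
      rw [abs_le]
      constructor <;> linarith
    simpa using pow_le_pow_left₀ (abs_nonneg _) h 2
  rw [EuclideanSpace.norm_eq]
  calc Real.sqrt (∑ i, ‖(y - z) i‖ ^ 2) ≤ Real.sqrt (n * l ^ 2) :=
        Real.sqrt_le_sqrt ((Finset.sum_le_sum fun i _ => hi i).trans (by simp))
    _ = Real.sqrt n * l := by rw [Real.sqrt_mul (by positivity), Real.sqrt_sq hl]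

theorem volume_cube_lt_top {n : ℕ} (c : Rn n) {l : ℝ} (hl : 0 ≤ l) :
    volume (cube c l) < ⊤ := by
  refine (measure_mono fun y hy => ?_).trans_lt
    (measure_closedBall_lt_top (x := c) (r := Real.sqrt n * l))
  rw [mem_closedBall_iff_norm]
  exact norm_sub_le_of_mem_cube hl hy fun i => by simpa using by positivity

/-- Off the dilated cube, the distances to any two points of the cube are comparable. -/
theorem norm_sub_le_two_mul_of_notMem_cube {n : ℕ} (hn : 1 ≤ n) {c x y z : Rn n} {l : ℝ}
    (hl : 0 < l) (hx : x ∉ cube c (8 * Real.sqrt n * l)) (hy : y ∈ cube c l)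
    (hz : z ∈ cube c l) : ‖x - y‖ ≤ 2 * ‖x - z‖ := by
  have hs : 1 ≤ Real.sqrt n := Real.one_le_sqrt.2 (by exact_mod_cast hn)
  have hsl : l ≤ Real.sqrt n * l := le_mul_of_one_le_left hl.le hs
  simp only [cube, mem_ofPred_eq, not_forall, not_le] at hx
  obtain ⟨i, hi⟩ := hx
  have h1 : |x i - z i| ≤ ‖x - z‖ := by simpa using PiLp.norm_apply_le (x - z) i
  have h2 : |x i - c i| ≤ |x i - z i| + |z i - c i| := abs_sub_le _ _ _
  have h3 := hz i
  have h4 : ‖x - y‖ ≤ ‖x - z‖ + ‖z - y‖ := norm_sub_le_norm_sub_add_norm_sub _ _ _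
  have h5 := norm_sub_le_of_mem_cube hl.le hz hy
  linarith

theorem integrable_inv_one_add_norm_pow {n : ℕ} (hn : 1 ≤ n) :
    Integrable fun z : Rn n => ((1 + ‖z‖) ^ (2 * n))⁻¹ := by
  have h := integrable_one_add_norm (E := Rn n) (μ := volume) (r := ((2 * n : ℕ) : ℝ)) (by
    rw [finrank_euclideanSpace_fin]
    exact_mod_cast (by omega : n < 2 * n))
  refine h.congr (.of_forall fun z => ?_)
  dsimp only
  rw [Real.rpow_neg (by positivity), Real.rpow_natCast]

theorem inv_add_norm_sub_pow_eq {n : ℕ} {d : ℝ} (hd : 0 < d) (x y : Rn n) :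
    ((d + ‖x - y‖) ^ (2 * n))⁻¹ =
      (d ^ (2 * n))⁻¹ * ((1 + ‖d⁻¹ • (x - y)‖) ^ (2 * n))⁻¹ := by
  rw [← mul_inv, ← mul_pow, norm_smul, Real.norm_of_nonneg (by positivity), mul_add, mul_one,
    mul_inv_cancel_left₀ hd.ne']

theorem integrable_inv_add_norm_sub_pow {n : ℕ} (hn : 1 ≤ n) {d : ℝ} (hd : 0 < d) (x : Rn n) :
    Integrable fun y : Rn n => ((d + ‖x - y‖) ^ (2 * n))⁻¹ := by
  simp only [inv_add_norm_sub_pow_eq hd]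
  exact (((integrable_inv_one_add_norm_pow hn).comp_smul (inv_ne_zero hd.ne')).comp_sub_left
    x).const_mul _

theorem integral_inv_add_norm_sub_pow {n : ℕ} {d : ℝ} (hd : 0 < d) (x : Rn n) :
    ∫ y : Rn n, ((d + ‖x - y‖) ^ (2 * n))⁻¹ =
      (d ^ n)⁻¹ * ∫ z : Rn n, ((1 + ‖z‖) ^ (2 * n))⁻¹ := by
  simp only [inv_add_norm_sub_pow_eq hd]
  rw [integral_const_mul,
    integral_sub_left_eq_self (fun z : Rn n => ((1 + ‖d⁻¹ • z‖) ^ (2 * n))⁻¹) volume x,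
    Measure.integral_comp_smul volume (fun z : Rn n => ((1 + ‖z‖) ^ (2 * n))⁻¹) d⁻¹,
    finrank_euclideanSpace_fin, smul_eq_mul, ← mul_assoc, inv_pow, inv_inv,
    abs_of_pos (by positivity)]
  congr 1
  field_simp
  ring

theorem iSup_inv_le {n : ℕ} (hn : 1 ≤ n) {c x y : Rn n} {l d : ℝ} (hl : 0 < l) (hd : 0 < d)
    (hx : x ∉ cube c (8 * Real.sqrt n * l)) (hy : y ∈ cube c l) :
    (⨆ z ∈ cube c l, ((d + ‖x - z‖) ^ (2 * n))⁻¹) ≤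
      4 ^ n * ((d + ‖x - y‖) ^ (2 * n))⁻¹ := by
  have h0 : 0 ≤ 4 ^ n * ((d + ‖x - y‖) ^ (2 * n))⁻¹ := by positivity
  refine Real.iSup_le (fun z => Real.iSup_le (fun hz => ?_) h0) h0
  have h := norm_sub_le_two_mul_of_notMem_cube hn hl hx hy hz
  have h4 : (4 : ℝ) ^ n = 2 ^ (2 * n) := by rw [pow_mul]; norm_num
  rw [← div_eq_mul_inv, h4, ← div_pow, ← inv_pow, inv_eq_one_div]
  refine pow_le_pow_left₀ (by positivity) ?_ _
  rw [div_le_div_iff₀ (by positivity) (by positivity)]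
  linarith

theorem volume_mul_iSup_inv_le {n : ℕ} (hn : 1 ≤ n) {c x : Rn n} {l d : ℝ} (hl : 0 < l)
    (hd : 0 < d) (hx : x ∉ cube c (8 * Real.sqrt n * l)) :
    (volume (cube c l)).toReal * (⨆ z ∈ cube c l, ((d + ‖x - z‖) ^ (2 * n))⁻¹) ≤
      4 ^ n * ∫ y in cube c l, ((d + ‖x - y‖) ^ (2 * n))⁻¹ := by
  rw [← integral_const_mul, ← measureReal_def, ← smul_eq_mul, ← setIntegral_const]
  exact setIntegral_mono_on (integrableOn_const (volume_cube_lt_top c hl.le).ne)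
    ((integrable_inv_add_norm_sub_pow hn hd x).const_mul _).integrableOn
    (isClosed_cube c l).measurableSet fun y hy => iSup_inv_le hn hl hd hx hy

/-- There is `C = C(n)` such that for pairwise disjoint cubes `S₁,…,S_N`,
`α > 0` and weights `0 ≤ μ_l ≤ α|S_l|`, for every `x` outside all the `8√n`-dilates and
every `y₁ ≠ x`, `∑_l μ_l · sup_{y₂ ∈ S_l} (|x−y₁|+|x−y₂|)^{−2n} ≤ C α |x−y₁|^{−n}`. -/
theorem stmt19 (n : ℕ) (hn : 1 ≤ n) :
    ∃ C : ℝ, 0 < C ∧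
      ∀ (N : ℕ) (cS : Fin N → Rn n) (lS : Fin N → ℝ), (∀ l, 0 < lS l) →
      (∀ l l' : Fin N, l ≠ l' →
        Disjoint (cube (cS l) (lS l)) (cube (cS l') (lS l'))) →
      ∀ (α : ℝ), 0 < α →
      ∀ (μ : Fin N → ℝ), (∀ l, 0 ≤ μ l) →
        (∀ l, μ l ≤ α * (volume (cube (cS l) (lS l))).toReal) →
      ∀ (x y₁ : Rn n), (∀ l, x ∉ cube (cS l) (8 * Real.sqrt n * lS l)) → y₁ ≠ x →
        (∑ l, μ l * ⨆ y₂ ∈ cube (cS l) (lS l), ((‖x - y₁‖ + ‖x - y₂‖) ^ (2 * n))⁻¹) ≤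
          C * α * (‖x - y₁‖ ^ n)⁻¹ := by
  refine ⟨4 ^ n * (∫ z : Rn n, ((1 + ‖z‖) ^ (2 * n))⁻¹) + 1, by positivity, ?_⟩
  intro N cS lS hl hdisj α hα μ _ hμα x y₁ hx hy
  have hd : 0 < ‖x - y₁‖ := norm_pos_iff.2 (sub_ne_zero.2 hy.symm)
  set d := ‖x - y₁‖
  have hint := integrable_inv_add_norm_sub_pow hn hd x
  calc (∑ l, μ l * ⨆ y₂ ∈ cube (cS l) (lS l), ((d + ‖x - y₂‖) ^ (2 * n))⁻¹)
      ≤ ∑ l, α * (4 ^ n * ∫ y in cube (cS l) (lS l), ((d + ‖x - y‖) ^ (2 * n))⁻¹) := by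
        refine Finset.sum_le_sum fun l _ => ?_
        refine (mul_le_mul_of_nonneg_right (hμα l) ?_).trans ?_
        · exact Real.iSup_nonneg fun y => Real.iSup_nonneg fun _ => by positivity
        · rw [mul_assoc]
          exact mul_le_mul_of_nonneg_left (volume_mul_iSup_inv_le hn (hl l) hd (hx l)) hα.le
    _ = α * (4 ^ n * ∫ y in ⋃ l, cube (cS l) (lS l), ((d + ‖x - y‖) ^ (2 * n))⁻¹) := by
        rw [← Finset.mul_sum, ← Finset.mul_sum, integral_iUnion_fintype
          (fun l => (isClosed_cube _ _).measurableSet) (fun l l' h => hdisj l l' h)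
          (fun l => hint.integrableOn)]
    _ ≤ α * (4 ^ n * ∫ y, ((d + ‖x - y‖) ^ (2 * n))⁻¹) := by
        gcongr ?_ * (?_ * ?_)
        exact setIntegral_le_integral hint (.of_forall fun y => by positivity)
    _ = (4 ^ n * ∫ z : Rn n, ((1 + ‖z‖) ^ (2 * n))⁻¹) * α * (d ^ n)⁻¹ := by
        rw [integral_inv_add_norm_sub_pow hd]
        ring
    _ ≤ _ := by
        gcongr
        linarith
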